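/- Let u0(x) = Σ_{n=0}^∞ a_n x^n be an entire function whose Taylor coefficients a_n are all real and nonnegative. Suppose there exists a function u, holomorphic on a neighborhood of the origin in ℂ², satisfying the KdV equation u_t + 6 u u_x + u_{xxx} = 0 on that neighborhood and u(x, 0) = u0(x) for all x near 0. Then a_n = 0 for all n ≥ 2; that is, u0(x) = a_0 + a_1 x. -/

import Mathlib

open Filter

lemma jp_line_deriv {F : ℂ × ℂ → ℂ} {q : ℂ × ℂ} (h : DifferentiableAt ℂ F q) (v : ℂ × ℂ) :
    deriv (fun ζ : ℂ => F (q + ζ • v)) 0 = fderiv ℂ F q v := by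
  have h1 : HasDerivAt (fun ζ : ℂ => q + ζ • v) v 0 := by
    simpa using ((hasDerivAt_id (0:ℂ)).smul_const v).const_add q
  have h2 : HasFDerivAt F (fderiv ℂ F q) (q + (0:ℂ) • v) := by simpa using h.hasFDerivAt
  exact (h2.comp_hasDerivAt (0:ℂ) h1).deriv

lemma jp_dir_diff {F : ℂ × ℂ → ℂ} {V : Set (ℂ × ℂ)} (hV : IsOpen V)
    (hF : DifferentiableOn ℂ F V) (e : ℂ × ℂ) (he : ‖e‖ ≤ 1) :
    DifferentiableOn ℂ (fun p => fderiv ℂ F p e) V := by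
  intro p0 hp0
  obtain ⟨ε, hε, hball⟩ := Metric.isOpen_iff.1 hV p0 hp0
  set r := ε / 4 with hr
  have hr0 : 0 < r := by positivity
  have hsub : Metric.closedBall p0 (3 * r) ⊆ V := fun x hx => hball (by
    simp only [Metric.mem_closedBall, Metric.mem_ball] at *; linarith)
  obtain ⟨M, hM⟩ := (isCompact_closedBall p0 (3 * r)).exists_bound_of_continuousOn
    (hF.continuousOn.mono hsub)
  have hM0 : 0 ≤ M := (norm_nonneg _).trans (hM p0 (by simp; positivity))
  -- moving along lines
  have hmove : ∀ (q v : ℂ × ℂ) (ζ : ℂ) (s : ℝ), q ∈ Metric.closedBall p0 s → ‖v‖ ≤ 1 → ‖ζ‖ ≤ r →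
      q + ζ • v ∈ Metric.closedBall p0 (s + r) := by
    intro q v ζ s hq hv hζ
    rw [Metric.mem_closedBall, dist_eq_norm] at *
    calc ‖q + ζ • v - p0‖ = ‖(q - p0) + ζ • v‖ := by congr 1; abel
      _ ≤ ‖q - p0‖ + ‖ζ‖ * ‖v‖ := by
        refine (norm_add_le _ _).trans ?_
        rw [norm_smul]
      _ ≤ s + r * 1 := by gcongr
      _ = s + r := by ring
  have hdiffAt : ∀ q ∈ Metric.closedBall p0 (3 * r), DifferentiableAt ℂ F q := fun q hq =>
    hF.differentiableAt (hV.mem_nhds (hsub hq))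
  have hline : ∀ (q v : ℂ × ℂ), q ∈ Metric.closedBall p0 (2 * r) → ‖v‖ ≤ 1 →
      DifferentiableOn ℂ (fun ζ : ℂ => F (q + ζ • v)) (Metric.closedBall 0 r) := by
    intro q v hq hv ζ hζ
    have h1 := hdiffAt (q + ζ • v) (by
      have := hmove q v ζ (2 * r) hq hv (by simpa using hζ)
      convert this using 2; ring)
    have h2 : DifferentiableAt ℂ (fun ζ : ℂ => q + ζ • v) ζ := by fun_prop
    exact (DifferentiableAt.comp ζ h1 h2).differentiableWithinAt
  -- bound on the derivative
  have hbd : ∀ q ∈ Metric.closedBall p0 (2 * r), ‖fderiv ℂ F q‖ ≤ M / r := by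
    intro q hq
    refine ContinuousLinearMap.opNorm_le_of_unit_norm (𝕜 := ℝ) (f := (fderiv ℂ F q).restrictScalars ℝ)
      (by positivity) ?_
    intro v hv
    change ‖fderiv ℂ F q v‖ ≤ _
    rw [← jp_line_deriv (hdiffAt q (Metric.closedBall_subset_closedBall (by linarith) hq)) v]
    refine Complex.norm_deriv_le_of_forall_mem_sphere_norm_le hr0 ?_ ?_
    · exact ((hline q v hq hv.le).mono Metric.closure_ball_subset_closedBall).diffContOnCl
    · intro z hz
      apply hM
      have := hmove q v z (2 * r) hq hv.le (by simpa using (mem_sphere_zero_iff_norm.1 hz).le)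
      convert this using 2; ring
  -- Cauchy formula
  have hcirc : ∀ θ : ℝ, ‖circleMap 0 r θ‖ ≤ r := fun θ => by simp [abs_of_pos hr0]
  have hcauchy : ∀ p ∈ Metric.ball p0 r, fderiv ℂ F p e = (2 * Real.pi * Complex.I)⁻¹ *
      ∫ θ in (0:ℝ)..2 * Real.pi, (deriv (circleMap 0 r) θ * (1 / (circleMap 0 r θ) ^ 2)) *
        F (p + circleMap 0 r θ • e) := by
    intro p hp
    have hp2 : p ∈ Metric.closedBall p0 (2 * r) :=
      Metric.ball_subset_closedBall.trans (Metric.closedBall_subset_closedBall (by linarith)) hp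
    have h1 := DifferentiableOn.deriv_eq_smul_circleIntegral hr0 (hline p e hp2 he)
    rw [jp_line_deriv (hdiffAt p (Metric.closedBall_subset_closedBall (by linarith) hp2)) e] at h1
    rw [circleIntegral] at h1
    simp only [smul_eq_mul, sub_zero, ← mul_assoc] at h1
    rw [h1, ← mul_assoc, inv_mul_cancel₀, one_mul]
    simp
  have hpc : ∀ p ∈ Metric.ball p0 r, ∀ θ : ℝ,
      p + circleMap 0 r θ • e ∈ Metric.closedBall p0 (2 * r) := by
    intro p hp θ
    have := hmove p e (circleMap 0 r θ) r (Metric.ball_subset_closedBall hp) he (hcirc θ)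
    convert this using 2; ring
  have hkc : Continuous (fun θ : ℝ => deriv (circleMap 0 r) θ * (1 / (circleMap 0 r θ) ^ 2)) := by
    have h0 : ∀ θ, circleMap 0 r θ ≠ 0 := fun θ => by
      simpa using circleMap_ne_center hr0.ne' (c := 0) (θ := θ)
    simp only [deriv_circleMap]
    have hc := continuous_circleMap 0 r
    refine (hc.mul continuous_const).mul (continuous_const.div (hc.pow 2) fun θ => pow_ne_zero _ (h0 θ))
  obtain ⟨K, hK⟩ := (isCompact_uIcc (a := (0:ℝ)) (b := 2 * Real.pi)).exists_bound_of_continuousOn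
    hkc.continuousOn
  have hcont : ∀ p ∈ Metric.ball p0 r, Continuous (fun θ : ℝ =>
      (deriv (circleMap 0 r) θ * (1 / (circleMap 0 r θ) ^ 2)) * F (p + circleMap 0 r θ • e)) := by
    intro p hp
    refine hkc.mul ?_
    have h1 : Continuous (fun θ : ℝ => p + circleMap 0 r θ • e) :=
      continuous_const.add ((continuous_circleMap 0 r).smul continuous_const)
    refine (hF.continuousOn.mono hsub).comp_continuous h1 fun θ => ?_
    exact Metric.closedBall_subset_closedBall (by linarith) (hpc p hp θ)
  have hK0 : 0 ≤ K := (norm_nonneg _).trans (hK 0 Set.left_mem_uIcc)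
  have hmain := hasFDerivAt_integral_of_dominated_of_fderiv_le (𝕜 := ℂ) (x₀ := p0)
    (s := Metric.ball p0 r) (μ := MeasureTheory.volume.restrict (Set.Ioc 0 (2 * Real.pi)))
    (F := fun p θ => (deriv (circleMap 0 r) θ * (1 / (circleMap 0 r θ) ^ 2)) *
        F (p + circleMap 0 r θ • e))
    (F' := fun p θ => (deriv (circleMap 0 r) θ * (1 / (circleMap 0 r θ) ^ 2)) •
        fderiv ℂ F (p + circleMap 0 r θ • e))
    (bound := fun _ => K * (M / r)) (Metric.ball_mem_nhds p0 hr0)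
    (by
      filter_upwards [Metric.ball_mem_nhds p0 hr0] with p hp
      exact (hcont p hp).aestronglyMeasurable)
    (((hcont p0 (Metric.mem_ball_self hr0)).intervalIntegrable 0 (2 * Real.pi)).1)
    (by
      refine hkc.aestronglyMeasurable.smul ?_
      have h1 : Continuous (fun θ : ℝ => p0 + circleMap 0 r θ • e) :=
        continuous_const.add ((continuous_circleMap 0 r).smul continuous_const)
      exact ((measurable_fderiv ℂ F).comp h1.measurable).stronglyMeasurable.aestronglyMeasurable)
    (by
      refine (MeasureTheory.ae_restrict_iff' measurableSet_Ioc).2 (Eventually.of_forall ?_)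
      intro θ hθ p hp
      rw [norm_smul]
      gcongr
      · exact hK θ (Set.Icc_subset_uIcc (Set.Ioc_subset_Icc_self hθ))
      · exact hbd _ (hpc p hp θ))
    ((intervalIntegrable_const (μ := MeasureTheory.volume) (a := 0) (b := 2 * Real.pi)).1)
    (by
      refine Eventually.of_forall ?_
      intro θ p hp
      have h1 := (hdiffAt _ (Metric.closedBall_subset_closedBall (by linarith) (hpc p hp θ))).hasFDerivAt
      have h2 : HasFDerivAt (fun p : ℂ × ℂ => p + circleMap 0 r θ • e)
        (ContinuousLinearMap.id ℂ _) p := (hasFDerivAt_id p).add_const _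
      have h3 := (h1.comp p h2).const_mul (deriv (circleMap 0 r) θ * (1 / (circleMap 0 r θ) ^ 2))
      simpa using h3)
  have := (hmain.const_mul ((2 * Real.pi * Complex.I)⁻¹)).differentiableAt
  refine (this.congr_of_eventuallyEq ?_).differentiableWithinAt
  filter_upwards [Metric.ball_mem_nhds p0 hr0] with p hp
  rw [hcauchy p hp, intervalIntegral.integral_of_le Real.two_pi_pos.le]
lemma jp_growth (e : ℕ → ℕ → ℝ) (n : ℕ) (hn : 2 ≤ n) (α : ℝ) (hα : 0 < α)
    (h0 : ∀ m k, 0 ≤ e m k) (hinit : e n 0 = n.factorial * α)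
    (h1 : ∀ m k, e (m + 3) k ≤ e m (k + 1))
    (h2 : ∀ m k, n ≤ m → 6 * (m.choose n) * e n 0 * e (m - n + 1) k ≤ e m (k + 1))
    (C R : ℝ) (hR : 0 < R) (hC : ∀ k, e n k ≤ C * k.factorial * R ^ k) : False := by
  have hd : ∀ k : ℕ, (((n - 1) * k + n).factorial : ℝ) * k.factorial * α ^ (k + 1)
      ≤ e ((n - 1) * k + n) k := by
    intro k
    induction k with
    | zero => simp [hinit]
    | succ k ih =>
      obtain ⟨l, rfl⟩ : ∃ l, n = l + 1 := ⟨n - 1, by omega⟩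
      simp only [Nat.add_sub_cancel] at *
      have hl : 1 ≤ l := by omega
      set q := l * k + l with hq
      have e1 : l * k + (l + 1) = q + 1 := by omega
      have e2 : l * (k + 1) + (l + 1) = q + (l + 1) := by rw [hq]; ring
      rw [e1] at ih
      rw [e2]
      have h3 := h2 (q + (l + 1)) k (by omega)
      rw [Nat.add_sub_cancel, hinit] at h3
      refine le_trans ?_ h3
      have hch := Nat.add_choose_mul_factorial_mul_factorial q (l + 1)
      have hch' : ((q + (l + 1)).choose (l + 1) : ℝ) * q.factorial * (l + 1).factorial
        = (q + (l + 1)).factorial := by exact_mod_cast hch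
      have hqk : ((k : ℝ) + 1) ≤ q + 1 := by
        have : k ≤ q := by rw [hq]; nlinarith
        exact_mod_cast Nat.succ_le_succ this
      rw [← hch', Nat.factorial_succ k]
      rw [Nat.factorial_succ q] at ih
      push_cast at ih ⊢
      set c : ℝ := ((q + (l + 1)).choose (l + 1) : ℝ)
      set f : ℝ := ((l + 1).factorial : ℝ)
      calc c * q.factorial * f * (((k:ℝ) + 1) * k.factorial) * α ^ (k + 1 + 1)
          ≤ c * q.factorial * f * (((q:ℝ) + 1) * k.factorial) * α ^ (k + 1 + 1) := by gcongr
        _ = 1 * (c * (f * α) * (((q:ℝ) + 1) * q.factorial * k.factorial * α ^ (k + 1))) := by ring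
        _ ≤ 6 * (c * (f * α) * (((q:ℝ) + 1) * q.factorial * k.factorial * α ^ (k + 1))) := by
          gcongr; norm_num
        _ ≤ 6 * (c * (f * α) * e (q + 1) k) := by gcongr
        _ = _ := by ring
  have hs : ∀ j m k, e (m + 3 * j) k ≤ e m (k + j) := by
    intro j
    induction j with
    | zero => intro m k; simp
    | succ j ih =>
      intro m k
      have := ih (m + 3) k
      have h3 := h1 m (k + j)
      rw [show m + 3 + 3 * j = m + 3 * (j + 1) by ring] at this
      exact this.trans h3
  have key : ∀ i : ℕ, (i.factorial : ℝ) ≤ (C / α) * ((2 * R) ^ (n + 2) / α ^ 3) ^ i := by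
    intro i
    set N := (n - 1) * i with hN
    have hiN : i ≤ N := by rw [hN]; exact Nat.le_mul_of_pos_left _ (by omega)
    have a1 := hd (3 * i)
    rw [show (n - 1) * (3 * i) + n = n + 3 * N by rw [hN]; ring] at a1
    have a2 := (a1.trans (hs N n (3 * i))).trans (hC _)
    have hexp : 3 * i + N = (n + 2) * i := by
      obtain ⟨l, rfl⟩ : ∃ l, n = l + 1 := ⟨n - 1, by omega⟩
      rw [hN]; simp; ring
    have hb : ((3 * i + N).factorial : ℝ) ≤ 2 ^ (3 * i + N) * ((3 * i).factorial * N.factorial) := by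
      have := Nat.add_choose_mul_factorial_mul_factorial (3 * i) N
      rw [← this, mul_assoc]
      have := Nat.choose_le_two_pow (3 * i + N) N
      exact_mod_cast Nat.mul_le_mul_right _ this
    have hc : (N.factorial : ℝ) * i.factorial ≤ (n + 3 * N).factorial := by
      have h5 := Nat.factorial_mul_factorial_dvd_factorial_add N i
      have h6 := Nat.le_of_dvd (Nat.factorial_pos _) h5
      have h7 : (N + i).factorial ≤ (n + 3 * N).factorial := Nat.factorial_le (by omega)
      exact_mod_cast h6.trans h7
    have hC0 : 0 ≤ C := by
      have := (h0 n 0).trans (hC 0)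
      simpa using this
    have a3 : (N.factorial * (3 * i).factorial : ℝ) * (i.factorial * α ^ (3 * i + 1)) ≤
        (N.factorial * (3 * i).factorial : ℝ) * (C * (2 * R) ^ (3 * i + N)) := by
      calc (N.factorial * (3 * i).factorial : ℝ) * (i.factorial * α ^ (3 * i + 1))
          = (N.factorial * i.factorial) * (3 * i).factorial * α ^ (3 * i + 1) := by ring
        _ ≤ (n + 3 * N).factorial * (3 * i).factorial * α ^ (3 * i + 1) := by gcongr
        _ ≤ _ := a2
        _ ≤ C * (2 ^ (3 * i + N) * ((3 * i).factorial * N.factorial)) * R ^ (3 * i + N) := by gcongr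
        _ = _ := by rw [mul_pow]; ring
    have a4 := le_of_mul_le_mul_left a3 (by positivity)
    rw [hexp] at a4
    rw [div_pow, ← pow_mul, ← pow_mul, div_mul_div_comm, le_div_iff₀ (by positivity)]
    calc _ = (i.factorial : ℝ) * α ^ (3 * i + 1) := by ring
      _ ≤ _ := a4
  set K := (2 * R) ^ (n + 2) / α ^ 3
  have ht := (FloorSemiring.tendsto_pow_div_factorial_atTop K).const_mul (C / α)
  rw [mul_zero] at ht
  obtain ⟨i, hi⟩ := (ht.eventually (gt_mem_nhds (show (0:ℝ) < 1 by norm_num))).exists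
  have := key i
  have hf : (0:ℝ) < i.factorial := by positivity
  rw [← mul_div_assoc, div_lt_one hf] at hi
  linarith

noncomputable def jpDx (F : ℂ × ℂ → ℂ) : ℂ × ℂ → ℂ := fun p => fderiv ℂ F p (1, 0)
noncomputable def jpDt (F : ℂ × ℂ → ℂ) : ℂ × ℂ → ℂ := fun p => fderiv ℂ F p (0, 1)

section jp
variable {V : Set (ℂ × ℂ)} (hV : IsOpen V)

lemma jpDx_diff (hV : IsOpen V) {F : ℂ × ℂ → ℂ} (hF : DifferentiableOn ℂ F V) :
    DifferentiableOn ℂ (jpDx F) V :=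
  jp_dir_diff hV hF _ (by simp [Prod.norm_def])

lemma jpDt_diff (hV : IsOpen V) {F : ℂ × ℂ → ℂ} (hF : DifferentiableOn ℂ F V) :
    DifferentiableOn ℂ (jpDt F) V :=
  jp_dir_diff hV hF _ (by simp [Prod.norm_def])

lemma jpDx_iter_diff (hV : IsOpen V) {F : ℂ × ℂ → ℂ} (hF : DifferentiableOn ℂ F V) (m : ℕ) :
    DifferentiableOn ℂ (jpDx^[m] F) V := by
  induction m with
  | zero => exact hF
  | succ m ih => rw [Function.iterate_succ_apply']; exact jpDx_diff hV ih

lemma jpDt_iter_diff (hV : IsOpen V) {F : ℂ × ℂ → ℂ} (hF : DifferentiableOn ℂ F V) (m : ℕ) :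
    DifferentiableOn ℂ (jpDt^[m] F) V := by
  induction m with
  | zero => exact hF
  | succ m ih => rw [Function.iterate_succ_apply']; exact jpDt_diff hV ih

lemma jp_fderiv_congr (hV : IsOpen V) {F G : ℂ × ℂ → ℂ} (h : Set.EqOn F G V) {p : ℂ × ℂ} (hp : p ∈ V) :
    fderiv ℂ F p = fderiv ℂ G p :=
  Filter.EventuallyEq.fderiv_eq (by filter_upwards [hV.mem_nhds hp] with q hq using h hq)

lemma jpDx_congr (hV : IsOpen V) {F G : ℂ × ℂ → ℂ} (h : Set.EqOn F G V) :
    Set.EqOn (jpDx F) (jpDx G) V := fun p hp => by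
  simp only [jpDx, jp_fderiv_congr hV h hp]

lemma jpDt_congr (hV : IsOpen V) {F G : ℂ × ℂ → ℂ} (h : Set.EqOn F G V) :
    Set.EqOn (jpDt F) (jpDt G) V := fun p hp => by
  simp only [jpDt, jp_fderiv_congr hV h hp]

lemma jpDt_iter_congr (hV : IsOpen V) {F G : ℂ × ℂ → ℂ} (h : Set.EqOn F G V) (k : ℕ) :
    Set.EqOn (jpDt^[k] F) (jpDt^[k] G) V := by
  induction k with
  | zero => exact h
  | succ k ih => simp only [Function.iterate_succ_apply']; exact jpDt_congr hV ih

lemma jp_comm (hV : IsOpen V) {F : ℂ × ℂ → ℂ} (hF : DifferentiableOn ℂ F V) :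
    Set.EqOn (jpDt (jpDx F)) (jpDx (jpDt F)) V := by
  intro p hp
  have hdx := (jpDx_diff hV hF).differentiableAt (hV.mem_nhds hp)
  have hdt := (jpDt_diff hV hF).differentiableAt (hV.mem_nhds hp)
  have hrep : fderiv ℂ F = fun q => (jpDx F q) • ContinuousLinearMap.fst ℂ ℂ ℂ
      + (jpDt F q) • ContinuousLinearMap.snd ℂ ℂ ℂ := by
    funext q
    ext <;> simp [jpDx, jpDt]
  have hd2 : DifferentiableAt ℂ (fderiv ℂ F) p := by
    rw [hrep]
    exact (hdx.smul_const _).add (hdt.smul_const _)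
  have hsym := second_derivative_symmetric_of_eventually (𝕜 := ℂ) (f := F) (f' := fderiv ℂ F)
    (x := p) (by
      filter_upwards [hV.mem_nhds hp] with q hq
      exact (hF.differentiableAt (hV.mem_nhds hq)).hasFDerivAt) hd2.hasFDerivAt (0, 1) (1, 0)
  have hap : ∀ v w : ℂ × ℂ, fderiv ℂ (fun q => fderiv ℂ F q v) p w
      = fderiv ℂ (fderiv ℂ F) p w v := by
    intro v w
    rw [fderiv_clm_apply hd2 (differentiableAt_const v)]
    simp
  change fderiv ℂ (fun q => fderiv ℂ F q (1, 0)) p (0, 1)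
    = fderiv ℂ (fun q => fderiv ℂ F q (0, 1)) p (1, 0)
  rw [hap, hap, hsym]

lemma jp_comm1 (hV : IsOpen V) {F : ℂ × ℂ → ℂ} (hF : DifferentiableOn ℂ F V) (k : ℕ) :
    Set.EqOn (jpDt^[k] (jpDx F)) (jpDx (jpDt^[k] F)) V := by
  induction k with
  | zero => intro p _; rfl
  | succ k ih =>
    simp only [Function.iterate_succ_apply']
    exact (jpDt_congr hV ih).trans (jp_comm hV (jpDt_iter_diff hV hF k))

lemma jp_comm2 (hV : IsOpen V) {F : ℂ × ℂ → ℂ} (hF : DifferentiableOn ℂ F V) (k m : ℕ) :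
    Set.EqOn (jpDt^[k] (jpDx^[m] F)) (jpDx^[m] (jpDt^[k] F)) V := by
  induction m with
  | zero => intro p _; rfl
  | succ m ih =>
    simp only [Function.iterate_succ_apply']
    exact (jp_comm1 hV (jpDx_iter_diff hV hF m) k).trans (jpDx_congr hV ih)

lemma jp_slice_x (hV : IsOpen V) (t : ℂ) : IsOpen {x : ℂ | (x, t) ∈ V} :=
  hV.preimage (by fun_prop)

lemma jp_slice_t (hV : IsOpen V) (x : ℂ) : IsOpen {t : ℂ | (x, t) ∈ V} :=
  hV.preimage (by fun_prop)

lemma jp_diff_x {F : ℂ × ℂ → ℂ} (hF : DifferentiableOn ℂ F V) (t : ℂ) :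
    DifferentiableOn ℂ (fun x => F (x, t)) {x : ℂ | (x, t) ∈ V} :=
  hF.comp (f := fun x : ℂ => (x, t)) (by fun_prop) (fun _ h => h)

lemma jp_diff_t {F : ℂ × ℂ → ℂ} (hF : DifferentiableOn ℂ F V) (x : ℂ) :
    DifferentiableOn ℂ (fun t => F (x, t)) {t : ℂ | (x, t) ∈ V} :=
  hF.comp (f := fun t : ℂ => (x, t)) (by fun_prop) (fun _ h => h)

lemma jp_an_x (hV : IsOpen V) {F : ℂ × ℂ → ℂ} (hF : DifferentiableOn ℂ F V) {x t : ℂ}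
    (h : (x, t) ∈ V) : AnalyticAt ℂ (fun x => F (x, t)) x :=
  (jp_diff_x hF t).analyticAt ((jp_slice_x hV t).mem_nhds h)

lemma jp_an_t (hV : IsOpen V) {F : ℂ × ℂ → ℂ} (hF : DifferentiableOn ℂ F V) {x t : ℂ}
    (h : (x, t) ∈ V) : AnalyticAt ℂ (fun t => F (x, t)) t :=
  (jp_diff_t hF x).analyticAt ((jp_slice_t hV x).mem_nhds h)

lemma jp_deriv_x (hV : IsOpen V) {F : ℂ × ℂ → ℂ} (hF : DifferentiableOn ℂ F V) {x t : ℂ}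
    (h : (x, t) ∈ V) : deriv (fun x => F (x, t)) x = jpDx F (x, t) := by
  have h1 : HasDerivAt (fun x : ℂ => (x, t)) ((1, 0) : ℂ × ℂ) x :=
    (hasDerivAt_id x).prodMk (hasDerivAt_const x t)
  exact (HasFDerivAt.comp_hasDerivAt x
    (hF.differentiableAt (hV.mem_nhds h)).hasFDerivAt h1).deriv

lemma jp_deriv_t (hV : IsOpen V) {F : ℂ × ℂ → ℂ} (hF : DifferentiableOn ℂ F V) {x t : ℂ}
    (h : (x, t) ∈ V) : deriv (fun t => F (x, t)) t = jpDt F (x, t) := by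
  have h1 : HasDerivAt (fun t : ℂ => (x, t)) ((0, 1) : ℂ × ℂ) t :=
    (hasDerivAt_const t x).prodMk (hasDerivAt_id t)
  exact (HasFDerivAt.comp_hasDerivAt t
    (hF.differentiableAt (hV.mem_nhds h)).hasFDerivAt h1).deriv

lemma jp_iter_x (hV : IsOpen V) {F : ℂ × ℂ → ℂ} (hF : DifferentiableOn ℂ F V) (m : ℕ) {x t : ℂ}
    (h : (x, t) ∈ V) : iteratedDeriv m (fun x => F (x, t)) x = (jpDx^[m] F) (x, t) := by
  induction m generalizing x with
  | zero => simp
  | succ m ih =>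
    rw [iteratedDeriv_succ, Function.iterate_succ_apply',
      ← jp_deriv_x hV (jpDx_iter_diff hV hF m) h]
    refine Filter.EventuallyEq.deriv_eq ?_
    filter_upwards [(jp_slice_x hV t).mem_nhds h] with y hy using ih hy

lemma jp_iter_t (hV : IsOpen V) {F : ℂ × ℂ → ℂ} (hF : DifferentiableOn ℂ F V) (m : ℕ) {x t : ℂ}
    (h : (x, t) ∈ V) : iteratedDeriv m (fun t => F (x, t)) t = (jpDt^[m] F) (x, t) := by
  induction m generalizing t with
  | zero => simp
  | succ m ih =>
    rw [iteratedDeriv_succ, Function.iterate_succ_apply',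
      ← jp_deriv_t hV (jpDt_iter_diff hV hF m) h]
    refine Filter.EventuallyEq.deriv_eq ?_
    filter_upwards [(jp_slice_t hV x).mem_nhds h] with y hy using ih hy

end jp

lemma jp_one_var {F : ℂ × ℂ → ℂ} {V : Set (ℂ × ℂ)} (hV : IsOpen V) (hV0 : ((0, 0) : ℂ × ℂ) ∈ V)
    (hF : DifferentiableOn ℂ F V)
    (hpde : ∀ p ∈ V, jpDt F p = -(6 * (F p * jpDx F p) + (jpDx^[3] F) p)) :
    ∃ w : ℕ → ℂ → ℂ, (∀ k, AnalyticAt ℂ (w k) 0) ∧ (w 0 = fun x => F (x, 0)) ∧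
      (∀ k, w (k + 1) =ᶠ[nhds 0] fun x => -(6 * (∑ i ∈ Finset.range (k + 1),
        (k.choose i : ℂ) * w i x * deriv (w (k - i)) x) + iteratedDeriv 3 (w k) x)) ∧
      (∀ m, ∃ C R : ℝ, 0 < R ∧ ∀ k, ‖iteratedDeriv m (w k) 0‖ ≤ C * k.factorial * R ^ k) := by
  refine ⟨fun k x => (jpDt^[k] F) (x, 0), fun k => jp_an_x hV (jpDt_iter_diff hV hF k) hV0, rfl,
    ?_, ?_⟩
  · intro k
    filter_upwards [(jp_slice_x hV 0).mem_nhds hV0] with x hx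
    have hx' : (x, (0:ℂ)) ∈ V := hx
    rw [Function.iterate_succ_apply, jpDt_iter_congr hV (fun p hp => hpde p hp) k hx']
    have hG1 : DifferentiableOn ℂ (fun p => F p * jpDx F p) V := hF.mul (jpDx_diff hV hF)
    have hG2 := jpDx_iter_diff hV hF 3
    have hG : DifferentiableOn ℂ (fun p => -(6 * (F p * jpDx F p) + (jpDx^[3] F) p)) V :=
      ((hG1.const_mul 6).add hG2).neg
    rw [← jp_iter_t hV hG k hx', iteratedDeriv_fun_neg]
    have c1 := (jp_an_t hV hG1 hx').contDiffAt (n := k)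
    have c1' := (jp_an_t hV (hG1.const_mul 6) hx').contDiffAt (n := k)
    have c2 := (jp_an_t hV hG2 hx').contDiffAt (n := k)
    have c3 := (jp_an_t hV hF hx').contDiffAt (n := k)
    have c4 := (jp_an_t hV (jpDx_diff hV hF) hx').contDiffAt (n := k)
    rw [iteratedDeriv_fun_add c1' c2, iteratedDeriv_const_mul_field, iteratedDeriv_fun_mul c3 c4,
      jp_iter_t hV hG2 k hx', jp_comm2 hV hF k 3 hx',
      jp_iter_x hV (jpDt_iter_diff hV hF k) 3 hx']
    congr 3
    refine Finset.sum_congr rfl fun i _ => ?_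
    rw [jp_iter_t hV hF i hx', jp_iter_t hV (jpDx_diff hV hF) (k - i) hx',
      jp_comm1 hV hF (k - i) hx', jp_deriv_x hV (jpDt_iter_diff hV hF (k - i)) hx']
  · intro m
    have hG := jpDx_iter_diff hV hF m
    obtain ⟨ε, hε, hb⟩ := Metric.isOpen_iff.1 (jp_slice_t hV 0) 0 hV0
    have hsub : Metric.closedBall (0:ℂ) (ε / 2) ⊆ {t : ℂ | ((0:ℂ), t) ∈ V} := fun x hx => hb (by
      simp only [Metric.mem_closedBall, Metric.mem_ball] at *; linarith)
    have hd := (jp_diff_t hG 0).mono hsub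
    obtain ⟨M, hM⟩ := (isCompact_closedBall (0:ℂ) (ε / 2)).exists_bound_of_continuousOn
      hd.continuousOn
    refine ⟨M, (ε / 2)⁻¹, by positivity, fun k => ?_⟩
    rw [jp_iter_x hV (jpDt_iter_diff hV hF k) m hV0, ← jp_comm2 hV hF k m hV0,
      ← jp_iter_t hV hG k hV0]
    refine (Complex.norm_iteratedDeriv_le_of_forall_mem_sphere_norm_le k (half_pos hε)
      ((hd.mono Metric.closure_ball_subset_closedBall).diffContOnCl)
      (fun z hz => hM z (Metric.sphere_subset_closedBall hz))).trans (le_of_eq ?_)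
    rw [inv_pow, div_eq_mul_inv]; ring

lemma jp_taylor (a : ℕ → ℝ) (u0 : ℂ → ℂ)
    (hsum : ∀ x : ℂ, HasSum (fun n : ℕ => (a n : ℂ) * x ^ n) (u0 x)) (m : ℕ) :
    iteratedDeriv m u0 0 = m.factorial * a m := by
  have h1 : HasFPowerSeriesAt u0 (FormalMultilinearSeries.ofScalars ℂ (fun n => (a n : ℂ))) 0 := by
    rw [hasFPowerSeriesAt_iff]
    refine Eventually.of_forall fun z => ?_
    simpa [FormalMultilinearSeries.coeff_ofScalars, mul_comm] using hsum z
  have h2 := (HasFPowerSeriesAt.analyticAt h1).hasFPowerSeriesAt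
  have h3 := congrArg (fun p => FormalMultilinearSeries.coeff p m)
    (h1.eq_formalMultilinearSeries h2)
  simp only [FormalMultilinearSeries.coeff_ofScalars] at h3
  have : (m.factorial : ℂ) ≠ 0 := by exact_mod_cast m.factorial_ne_zero
  rw [h3]; field_simp

/-- signed derivative recursion -/
lemma jp_rec {w : ℕ → ℂ → ℂ} (hw : ∀ k, AnalyticAt ℂ (w k) 0)
    (hrec : ∀ k, w (k + 1) =ᶠ[nhds 0] fun x => -(6 * (∑ i ∈ Finset.range (k + 1),
        (k.choose i : ℂ) * w i x * deriv (w (k - i)) x) + iteratedDeriv 3 (w k) x))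
    (E : ℕ → ℕ → ℂ) (hE : ∀ m k, E m k = (-1) ^ k * iteratedDeriv m (w k) 0) (m k : ℕ) :
    E m (k + 1) = 6 * (∑ i ∈ Finset.range (k + 1), (k.choose i : ℂ) *
      ∑ j ∈ Finset.range (m + 1), (m.choose j : ℂ) * E j i * E (m - j + 1) (k - i)) + E (m + 3) k := by
  have hd : ∀ l k, iteratedDeriv l (deriv (w k)) 0 = iteratedDeriv (l + 1) (w k) 0 := by
    intro l k; rw [iteratedDeriv_succ']
  have hd3 : ∀ l k, iteratedDeriv l (iteratedDeriv 3 (w k)) 0 = iteratedDeriv (l + 3) (w k) 0 := by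
    intro l k
    simp only [iteratedDeriv_eq_iterate, ← Function.iterate_add_apply]
  have can : ∀ k, AnalyticAt ℂ (iteratedDeriv 3 (w k)) 0 := by
    intro k
    rw [iteratedDeriv_eq_iterate]
    exact (hw k).iterated_deriv 3
  have cprod : ∀ i, AnalyticAt ℂ (fun x => w i x * deriv (w (k - i)) x) 0 := fun i =>
    (hw i).mul (hw _).deriv
  have cterm : ∀ i, AnalyticAt ℂ (fun x => (k.choose i : ℂ) * (w i x * deriv (w (k - i)) x)) 0 :=
    fun i => analyticAt_const.mul (cprod i)
  have csum : AnalyticAt ℂ (fun x => ∑ i ∈ Finset.range (k + 1),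
        (k.choose i : ℂ) * (w i x * deriv (w (k - i)) x)) 0 :=
    Finset.analyticAt_fun_sum _ fun i _ => cterm i
  have csum6 : AnalyticAt ℂ (fun x => 6 * ∑ i ∈ Finset.range (k + 1),
        (k.choose i : ℂ) * (w i x * deriv (w (k - i)) x)) 0 := analyticAt_const.mul csum
  rw [hE, (hrec k).iteratedDeriv_eq m, iteratedDeriv_fun_neg]
  simp only [mul_assoc]
  rw [iteratedDeriv_fun_add csum6.contDiffAt (can k).contDiffAt,
    iteratedDeriv_const_mul_field, iteratedDeriv_fun_sum (fun i _ => (cterm i).contDiffAt), hd3, hE]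
  have hterm : ∀ i ∈ Finset.range (k + 1),
      iteratedDeriv m (fun x => (k.choose i : ℂ) * (w i x * deriv (w (k - i)) x)) 0
      = (-1) ^ k * ((k.choose i : ℂ) * ∑ j ∈ Finset.range (m + 1), (m.choose j : ℂ) *
        (E j i * E (m - j + 1) (k - i))) := by
    intro i hi
    have hik : i ≤ k := by simpa [Nat.lt_succ_iff] using hi
    rw [iteratedDeriv_const_mul_field,
      iteratedDeriv_fun_mul (hw i).contDiffAt (hw _).deriv.contDiffAt]
    rw [mul_left_comm ((-1 : ℂ) ^ k)]
    congr 1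
    rw [Finset.mul_sum]
    refine Finset.sum_congr rfl fun j _ => ?_
    rw [hE, hE, hd]
    have hs : ((-1 : ℂ)) ^ k = (-1) ^ i * (-1) ^ (k - i) := by
      rw [← pow_add]; congr 1; omega
    have s1 : ((-1 : ℂ) ^ i) * (-1) ^ i = 1 := by rw [← mul_pow]; simp
    have s2 : ((-1 : ℂ) ^ (k - i)) * (-1) ^ (k - i) = 1 := by rw [← mul_pow]; simp
    rw [hs]
    linear_combination (-(m.choose j : ℂ) * iteratedDeriv j (w i) 0 *
      iteratedDeriv (m - j + 1) (w (k - i)) 0) * (s1 * (-1) ^ (k - i) * (-1) ^ (k - i) + s2)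
  rw [Finset.sum_congr rfl hterm, ← Finset.mul_sum]
  have s3 : ((-1 : ℂ) ^ k) * (-1) ^ k = 1 := by rw [← mul_pow]; simp
  rw [pow_succ]
  linear_combination (6 * ∑ i ∈ Finset.range (k + 1), ((k.choose i : ℂ) *
    ∑ j ∈ Finset.range (m + 1), (m.choose j : ℂ) * (E j i * E (m - j + 1) (k - i)))) * s3

/-- Joshi–Petersen nonexistence result: if the initial data
`u0(x) = Σ aₙxⁿ` is entire with real nonnegative coefficients and the KdV
equation `u_t + 6uu_x + u_{xxx} = 0` admits a solution holomorphic in a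
neighbourhood of the origin of `ℂ²` with `u(x,0) = u0(x)`, then `aₙ = 0` for
all `n ≥ 2`, i.e. `u0(x) = a₀ + a₁x`. -/
theorem joshi_petersen_no_holomorphic_solution
    (a : ℕ → ℝ) (ha : ∀ n : ℕ, 0 ≤ a n)
    (u0 : ℂ → ℂ) (hsum : ∀ x : ℂ, HasSum (fun n : ℕ => (a n : ℂ) * x ^ n) (u0 x))
    (u : ℂ → ℂ → ℂ) (V : Set (ℂ × ℂ)) (hVopen : IsOpen V) (hV0 : ((0, 0) : ℂ × ℂ) ∈ V)
    (huhol : DifferentiableOn ℂ (fun p : ℂ × ℂ => u p.1 p.2) V)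
    (hpde : ∀ p ∈ V,
      deriv (fun t' => u p.1 t') p.2
        + 6 * u p.1 p.2 * deriv (fun x' => u x' p.2) p.1
        + iteratedDeriv 3 (fun x' => u x' p.2) p.1 = 0)
    (hinit : ∀ᶠ x in nhds (0 : ℂ), u x 0 = u0 x) :
    ∀ n : ℕ, 2 ≤ n → a n = 0 := by
  intro n hn
  by_contra hne
  have hpos : 0 < a n := lt_of_le_of_ne (ha n) (Ne.symm hne)
  set F : ℂ × ℂ → ℂ := fun p => u p.1 p.2 with hFdef
  have hpde' : ∀ p ∈ V, jpDt F p = -(6 * (F p * jpDx F p) + (jpDx^[3] F) p) := by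
    rintro ⟨x, t⟩ hp
    have h := hpde (x, t) hp
    have h1 := jp_deriv_t hVopen huhol hp
    have h2 := jp_deriv_x hVopen huhol hp
    have h3 := jp_iter_x hVopen huhol 3 hp
    simp only [hFdef] at h1 h2 h3 ⊢
    rw [← h1, ← h2, ← h3]
    simp only at h
    linear_combination h
  obtain ⟨w, hw, hw0, hrec, hgr⟩ := jp_one_var hVopen hV0 huhol hpde'
  set E : ℕ → ℕ → ℂ := fun m k => (-1) ^ k * iteratedDeriv m (w k) 0 with hEdef
  have hErec := jp_rec hw hrec E (fun _ _ => rfl)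
  have hE0 : ∀ m, E m 0 = ((m.factorial * a m : ℝ) : ℂ) := by
    intro m
    have : w 0 =ᶠ[nhds 0] u0 := by rw [hw0]; exact hinit
    simp only [hEdef, pow_zero, one_mul]
    rw [this.iteratedDeriv_eq m, jp_taylor a u0 hsum m]
    push_cast; rfl
  have hreal : ∀ k m, ∃ r : ℝ, 0 ≤ r ∧ E m k = r := by
    intro k
    induction k using Nat.strong_induction_on with
    | _ k ih =>
      intro m
      cases k with
      | zero => exact ⟨_, mul_nonneg (by positivity) (ha m), hE0 m⟩
      | succ k =>
        choose! f hf0 hf using ih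
        refine ⟨6 * (∑ i ∈ Finset.range (k + 1), (k.choose i : ℝ) *
          ∑ j ∈ Finset.range (m + 1), (m.choose j : ℝ) * f i j * f (k - i) (m - j + 1))
          + f k (m + 3), ?_, ?_⟩
        · refine add_nonneg (mul_nonneg (by norm_num) (Finset.sum_nonneg fun i hi =>
            mul_nonneg (by positivity) (Finset.sum_nonneg fun j _ =>
              mul_nonneg (mul_nonneg (by positivity) (hf0 _ ?_ _)) (hf0 _ ?_ _)))) (hf0 _ ?_ _)
          · exact Finset.mem_range.1 hi
          · omega
          · omega
        · rw [hErec]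
          push_cast
          congr 1
          · congr 1
            refine Finset.sum_congr rfl fun i hi => ?_
            congr 1
            refine Finset.sum_congr rfl fun j _ => ?_
            rw [hf i (Finset.mem_range.1 hi), hf (k - i) (by omega)]
          · exact hf k (by omega) _
  choose f hf0 hf using hreal
  have hfrec : ∀ m k, f (k + 1) m = 6 * (∑ i ∈ Finset.range (k + 1), (k.choose i : ℝ) *
      ∑ j ∈ Finset.range (m + 1), (m.choose j : ℝ) * f i j * f (k - i) (m - j + 1))
      + f k (m + 3) := by
    intro m k
    have := hErec m k
    simp only [hf] at this
    exact_mod_cast this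
  have hin : ∀ k m i, 0 ≤ ∑ j ∈ Finset.range (m + 1),
      (m.choose j : ℝ) * f i j * f (k - i) (m - j + 1) := fun k m i =>
    Finset.sum_nonneg fun j _ => mul_nonneg (mul_nonneg (by positivity) (hf0 _ _)) (hf0 _ _)
  obtain ⟨C, R, hR, hC⟩ := hgr n
  refine jp_growth (fun m k => f k m) n hn (a n) hpos (fun m k => hf0 k m) ?_ ?_ ?_ C R hR ?_
  · have h1 := hE0 n
    rw [hf] at h1
    exact_mod_cast h1
  · intro m k
    rw [hfrec]
    have : 0 ≤ ∑ i ∈ Finset.range (k + 1), (k.choose i : ℝ) *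
      ∑ j ∈ Finset.range (m + 1), (m.choose j : ℝ) * f i j * f (k - i) (m - j + 1) :=
      Finset.sum_nonneg fun i _ => mul_nonneg (by positivity) (hin k m i)
    linarith
  · intro m k hm
    rw [hfrec]
    have h1 := Finset.single_le_sum (f := fun i => (k.choose i : ℝ) *
      ∑ j ∈ Finset.range (m + 1), (m.choose j : ℝ) * f i j * f (k - i) (m - j + 1))
      (fun i _ => mul_nonneg (by positivity) (hin k m i))
      (Finset.mem_range.2 (Nat.succ_pos k))
    have h2 := Finset.single_le_sum (f := fun j => (m.choose j : ℝ) * f 0 j * f k (m - j + 1))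
      (fun j _ => mul_nonneg (mul_nonneg (by positivity) (hf0 _ _)) (hf0 _ _))
      (Finset.mem_range.2 (Nat.lt_succ_of_le hm))
    simp only [Nat.choose_zero_right, Nat.cast_one, one_mul, Nat.sub_zero] at h1 h2
    have h3 := hf0 k (m + 3)
    linarith
  · intro k
    have h1 := hC k
    have h2 : ‖E n k‖ = ‖iteratedDeriv n (w k) 0‖ := by simp [hEdef]
    rw [← h2, hf] at h1
    rw [Complex.norm_real, Real.norm_eq_abs] at h1
    exact (le_abs_self _).trans h1
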